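/- arXiv:1603.02239 — 2 statements merged into one kernel-verified Lean document; each statement's English description precedes it below -/
import Mathlib

section
/- Under the full assumptions and Algorithm 1, the errors e_i(k) = x_i(k) − z_i(k−1) satisfy: (1) ∑_{k=1}^∞ ∑_{i=1}^m ‖e_i(k)‖² < ∞, and (2) lim_{k→∞} ‖e_i(k)‖ = 0 for every i = 1,…,m. -/
open Filter Finset Metric
open scoped Topology BigOperators

section Prox

variable {E : Type*} [NormedAddCommGroup E] [InnerProductSpace ℝ E]

/-- A proximal step with step size `c` satisfies the three-point inequality. -/
theorem prox_three_point {S : Set E} (hS : Convex ℝ S) {f : E → ℝ}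
    (hf : ConvexOn ℝ Set.univ f) {c : ℝ} (hc : 0 < c) {z p y : E} (hp : p ∈ S) (hy : y ∈ S)
    (hmin : ∀ w ∈ S, f p + (1 / (2 * c)) * ‖z - p‖ ^ 2 ≤ f w + (1 / (2 * c)) * ‖z - w‖ ^ 2) :
    ‖p - y‖ ^ 2 ≤ ‖z - y‖ ^ 2 - ‖p - z‖ ^ 2 + 2 * c * (f y - f p) := by
  set α := 1 / (2 * c) with hα
  have hα0 : 0 < α := by positivity
  have key : ∀ t : ℝ, 0 < t → t ≤ 1 →
      f p - f y + 2 * α * inner ℝ (z - p) (y - p) ≤ t * (α * ‖y - p‖ ^ 2) := by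
    intro t ht ht1
    have hw := hmin _ (hS hp hy (sub_nonneg.2 ht1) ht.le (by ring))
    have hfw := hf.2 (Set.mem_univ p) (Set.mem_univ y) (sub_nonneg.2 ht1) ht.le (by ring)
    have hn : ‖z - ((1 - t) • p + t • y)‖ ^ 2
        = ‖z - p‖ ^ 2 - 2 * (t * inner ℝ (z - p) (y - p)) + t ^ 2 * ‖y - p‖ ^ 2 := by
      have : z - ((1 - t) • p + t • y) = (z - p) - t • (y - p) := by module
      rw [this, norm_sub_sq_real, inner_smul_right, norm_smul, mul_pow, Real.norm_eq_abs, sq_abs]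
    rw [hn] at hw
    simp only [smul_eq_mul] at hfw
    refine le_of_mul_le_mul_left ?_ ht
    linarith
  have hlim : f p - f y + 2 * α * inner ℝ (z - p) (y - p) ≤ 0 := by
    have ht : Tendsto (fun t : ℝ => t * (α * ‖y - p‖ ^ 2)) (𝓝[>] 0) (𝓝 0) := by
      have : Tendsto (fun t : ℝ => t * (α * ‖y - p‖ ^ 2)) (𝓝 0) (𝓝 (0 * (α * ‖y - p‖ ^ 2))) :=
        tendsto_id.mul_const _
      rw [zero_mul] at this
      exact this.mono_left nhdsWithin_le_nhds
    refine ge_of_tendsto ht ?_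
    filter_upwards [Ioc_mem_nhdsGT (zero_lt_one' ℝ)] with t h using key t h.1 h.2
  have hn : ‖z - y‖ ^ 2 = ‖z - p‖ ^ 2 - 2 * inner ℝ (z - p) (y - p) + ‖y - p‖ ^ 2 := by
    rw [← norm_sub_sq_real]; congr 2; abel
  have h2 : 2 * c * (f p - f y) + 2 * inner ℝ (z - p) (y - p) ≤ 0 := by
    have h := mul_le_mul_of_nonneg_left hlim (by positivity : 0 ≤ 2 * c)
    have hcα : 2 * c * α = 1 := by rw [hα]; field_simp
    linear_combination h - 2 * inner ℝ (z - p) (y - p) * hcα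
  rw [norm_sub_rev p y, norm_sub_rev p z]
  linarith

theorem norm_sum_smul_sub_sq_le {ι : Type*} [Fintype ι] {w : ι → ℝ} (hw : ∀ j, 0 ≤ w j)
    (hw1 : ∑ j, w j = 1) (x : ι → E) (y : E) :
    ‖∑ j, w j • x j - y‖ ^ 2 ≤ ∑ j, w j * ‖x j - y‖ ^ 2 := by
  have h : ∑ j, w j • x j - y = ∑ j, w j • (x j - y) := by
    simp only [smul_sub, sum_sub_distrib, ← sum_smul, hw1, one_smul]
  rw [h]
  have hc : ConvexOn ℝ (Set.univ : Set E) (fun v => ‖v‖ ^ 2) :=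
    (convexOn_norm convex_univ).pow (fun _ _ => norm_nonneg _) 2
  simpa using hc.map_sum_le (t := univ) (p := fun j => x j - y) (fun j _ => hw j) hw1
    (fun _ _ => Set.mem_univ _)

end Prox

section Interior

variable {E : Type*} [NormedAddCommGroup E] [NormedSpace ℝ E]

/-- If a family of convex sets has a common interior ball, then a point within `ε` of a point of
each set is within `ε / r` times its distance to the centre from a common point. -/
theorem exists_mem_iInter_norm_sub_le {ι : Type*} {X : ι → Set E} (hX : ∀ i, Convex ℝ (X i))
    {b : E} {r : ℝ} (hr : 0 < r) (hball : Metric.closedBall b r ⊆ ⋂ i, X i)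
    {x : ι → E} (hx : ∀ i, x i ∈ X i) {v : E} {ε : ℝ} (hε : 0 ≤ ε) (hv : ∀ i, ‖v - x i‖ ≤ ε) :
    ∃ s ∈ ⋂ i, X i, ‖s - v‖ ≤ ε / r * ‖b - v‖ := by
  have hpos : 0 < ε + r := by linarith
  refine ⟨(ε / (ε + r)) • b + (r / (ε + r)) • v, Set.mem_iInter.2 fun j => ?_, ?_⟩
  · have hu : b + (r / ε) • (v - x j) ∈ X j := by
      refine Set.mem_iInter.1 (hball ?_) j
      rw [mem_closedBall, dist_eq_norm, add_sub_cancel_left, norm_smul, Real.norm_eq_abs,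
        abs_of_nonneg (by positivity)]
      rcases hε.eq_or_lt with h | h
      · simp [← h, hr.le]
      · calc r / ε * ‖v - x j‖ ≤ r / ε * ε := by gcongr; exact hv j
          _ = r := by field_simp
    have hs := hX j hu (hx j) (a := ε / (ε + r)) (b := r / (ε + r)) (by positivity)
      (by positivity) (by field_simp)
    convert hs using 1
    rcases hε.eq_or_lt with h | h
    · have : v = x j := by
        have := hv j
        rw [← h] at this
        exact sub_eq_zero.1 (norm_le_zero_iff.1 this)
      simp [← h, this]
    · have : (ε / (ε + r)) * (r / ε) = r / (ε + r) := by field_simp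
      rw [smul_add, smul_smul, this]
      module
  · have h1 : (ε / (ε + r)) • b + (r / (ε + r)) • v - v = (ε / (ε + r)) • (b - v) := by
      have : r / (ε + r) = 1 - ε / (ε + r) := by field_simp; ring
      rw [this]; module
    rw [h1, norm_smul, Real.norm_eq_abs, abs_of_nonneg (by positivity)]
    gcongr
    linarith

end Interior

section Disagreement

variable {ι : Type*} [Fintype ι] {E : Type*} [NormedAddCommGroup E]

/-- The largest distance between two members of a finite family. -/
noncomputable def disagreement (x : ι → E) : ℝ := ‖fun p : ι × ι => x p.1 - x p.2‖

theorem disagreement_nonneg (x : ι → E) : 0 ≤ disagreement x := norm_nonneg _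

theorem norm_sub_le_disagreement (x : ι → E) (i j : ι) : ‖x i - x j‖ ≤ disagreement x :=
  norm_le_pi_norm (fun p : ι × ι => x p.1 - x p.2) (i, j)

theorem disagreement_le {x : ι → E} {d : ℝ} (hd : 0 ≤ d) (h : ∀ i j, ‖x i - x j‖ ≤ d) :
    disagreement x ≤ d :=
  (pi_norm_le_iff_of_nonneg hd).2 fun p => h p.1 p.2

theorem disagreement_add_le (x y : ι → E) :
    disagreement (x + y) ≤ disagreement x + disagreement y := by
  refine disagreement_le (add_nonneg (disagreement_nonneg x) (disagreement_nonneg y))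
    fun i j => ?_
  have h : (x + y) i - (x + y) j = (x i - x j) + (y i - y j) := by
    simp only [Pi.add_apply]; abel
  rw [h]
  exact (norm_add_le _ _).trans <|
    add_le_add (norm_sub_le_disagreement x i j) (norm_sub_le_disagreement y i j)

theorem disagreement_sq_le (x : ι → E) : disagreement x ^ 2 ≤ 4 * ∑ i, ‖x i‖ ^ 2 := by
  have hS : 0 ≤ ∑ i, ‖x i‖ ^ 2 := sum_nonneg fun i _ => sq_nonneg _
  have hi : ∀ i, ‖x i‖ ≤ √(∑ i, ‖x i‖ ^ 2) := fun i =>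
    Real.le_sqrt_of_sq_le (single_le_sum (f := fun i => ‖x i‖ ^ 2) (fun i _ => sq_nonneg _)
      (mem_univ i))
  have h : disagreement x ≤ 2 * √(∑ i, ‖x i‖ ^ 2) :=
    disagreement_le (by positivity) fun i j =>
      (norm_sub_le _ _).trans (by linarith [hi i, hi j])
  calc disagreement x ^ 2 ≤ (2 * √(∑ i, ‖x i‖ ^ 2)) ^ 2 :=
        pow_le_pow_left₀ (disagreement_nonneg x) h 2
    _ = 4 * ∑ i, ‖x i‖ ^ 2 := by rw [mul_pow, Real.sq_sqrt hS]; norm_num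

end Disagreement

section Mixing

variable {ι : Type*} [Fintype ι] {E : Type*} [NormedAddCommGroup E] [NormedSpace ℝ E]

/-- The action of a real matrix on a family of vectors. -/
def mix (P : Matrix ι ι ℝ) (x : ι → E) : ι → E := fun i => ∑ j, P i j • x j

theorem mix_sub (P : Matrix ι ι ℝ) (x y : ι → E) : mix P (x - y) = mix P x - mix P y := by
  ext i; simp [mix, smul_sub]

theorem mix_one [DecidableEq ι] (x : ι → E) : mix 1 x = x := by
  ext i; simp [mix, Matrix.one_apply]

theorem mix_mul (P Q : Matrix ι ι ℝ) (x : ι → E) : mix (P * Q) x = mix P (mix Q x) := by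
  ext i
  simp only [mix, Matrix.mul_apply, sum_smul, smul_sum, smul_smul]
  exact sum_comm

theorem norm_sum_smul_sub_sum_smul_le {r : ℝ} {p q : ι → ℝ} (hp : ∀ l, 0 ≤ p l)
    (hq : ∀ l, 0 ≤ q l) (hpr : ∑ l, p l = r) (hqr : ∑ l, q l = r) (x : ι → E) :
    ‖∑ l, p l • x l - ∑ l, q l • x l‖ ≤ r * disagreement x := by
  have hr : 0 ≤ r := hpr ▸ sum_nonneg fun l _ => hp l
  rcases hr.eq_or_lt with h0 | hr
  · have hp0 : ∀ l, p l = 0 := fun l =>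
      (sum_eq_zero_iff_of_nonneg fun l _ => hp l).1 (hpr.trans h0.symm) l (mem_univ l)
    have hq0 : ∀ l, q l = 0 := fun l =>
      (sum_eq_zero_iff_of_nonneg fun l _ => hq l).1 (hqr.trans h0.symm) l (mem_univ l)
    simp [hp0, hq0, ← h0]
  · have h : r • (∑ l, p l • x l - ∑ l, q l • x l)
        = ∑ l, ∑ l', (p l * q l') • (x l - x l') := by
      simp only [smul_sub, sum_sub_distrib]
      congr 1
      · rw [smul_sum]
        refine sum_congr rfl fun l _ => ?_
        rw [← sum_smul, ← mul_sum, hqr, smul_smul, mul_comm]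
      · rw [sum_comm, smul_sum]
        refine sum_congr rfl fun l _ => ?_
        rw [← sum_smul, ← sum_mul, hpr, smul_smul]
    refine le_of_mul_le_mul_left ?_ hr
    calc r * ‖∑ l, p l • x l - ∑ l, q l • x l‖
        = ‖r • (∑ l, p l • x l - ∑ l, q l • x l)‖ := by
          rw [norm_smul, Real.norm_of_nonneg hr.le]
      _ ≤ ∑ l, ∑ l', p l * q l' * disagreement x := by
          rw [h]
          refine norm_sum_le_of_le _ fun l _ => norm_sum_le_of_le _ fun l' _ => ?_
          rw [norm_smul, Real.norm_of_nonneg (mul_nonneg (hp l) (hq l'))]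
          exact mul_le_mul_of_nonneg_left (norm_sub_le_disagreement x l l')
            (mul_nonneg (hp l) (hq l'))
      _ = r * (r * disagreement x) := by
          simp only [← sum_mul, ← mul_sum, hqr, hpr, mul_assoc]

/-- A row-stochastic matrix with entries at least `δ` contracts the disagreement. -/
theorem disagreement_mix_le {P : Matrix ι ι ℝ} {δ : ℝ} (hP : ∀ i j, δ ≤ P i j)
    (hP1 : ∀ i, ∑ j, P i j = 1) (x : ι → E) :
    disagreement (mix P x) ≤ (1 - Fintype.card ι * δ) * disagreement x := by
  have hrow : ∀ i, ∑ j, (P i j - δ) = 1 - Fintype.card ι * δ := fun i => by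
    simp [sum_sub_distrib, hP1 i]
  have hnn : ∀ i j, ‖mix P x i - mix P x j‖ ≤ (1 - Fintype.card ι * δ) * disagreement x := by
    intro i j
    have h := norm_sum_smul_sub_sum_smul_le (fun l => sub_nonneg.2 (hP i l))
      (fun l => sub_nonneg.2 (hP j l)) (hrow i) (hrow j) x
    simpa only [mix, sub_smul, sum_sub_distrib, sub_sub_sub_cancel_right] using h
  cases isEmpty_or_nonempty ι with
  | inl _ => simp [disagreement, Subsingleton.elim (fun p : ι × ι => _ - _) (0 : ι × ι → E)]
  | inr h => exact disagreement_le ((norm_nonneg _).trans (hnn h.some h.some)) hnn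

theorem disagreement_mix_le_self {P : Matrix ι ι ℝ} (hP : ∀ i j, 0 ≤ P i j)
    (hP1 : ∀ i, ∑ j, P i j = 1) (x : ι → E) : disagreement (mix P x) ≤ disagreement x := by
  simpa using disagreement_mix_le hP hP1 x

variable [DecidableEq ι]

/-- The product `a (k + s - 1) * ⋯ * a k` of weight matrices. -/
def transition (a : ℕ → Matrix ι ι ℝ) (k : ℕ) : ℕ → Matrix ι ι ℝ
  | 0 => 1
  | s + 1 => a (k + s) * transition a k s

variable {a : ℕ → Matrix ι ι ℝ}

theorem transition_nonneg (ha : ∀ k i j, 0 ≤ a k i j) (k s : ℕ) (i j : ι) :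
    0 ≤ transition a k s i j := by
  induction s generalizing i with
  | zero => simp only [transition, Matrix.one_apply]; split_ifs <;> norm_num
  | succ s ih => exact sum_nonneg fun l _ => mul_nonneg (ha _ _ _) (ih l)

theorem transition_row_sum (ha1 : ∀ k i, ∑ j, a k i j = 1) (k s : ℕ) (i : ι) :
    ∑ j, transition a k s i j = 1 := by
  induction s generalizing i with
  | zero => simp [transition, Matrix.one_apply]
  | succ s ih =>
    simp only [transition, Matrix.mul_apply]
    rw [sum_comm]
    simp [← mul_sum, ih, ha1]

theorem mul_le_transition_succ (ha : ∀ k i j, 0 ≤ a k i j) (k s : ℕ) (i l j : ι) :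
    a (k + s) i l * transition a k s l j ≤ transition a k (s + 1) i j := by
  simp only [transition, Matrix.mul_apply]
  exact single_le_sum (f := fun l => a (k + s) i l * transition a k s l j)
    (fun l _ => mul_nonneg (ha _ _ _) (transition_nonneg ha _ _ _ _)) (mem_univ l)

theorem pow_le_transition_of_le (ha : ∀ k i j, 0 ≤ a k i j) {η : ℝ} (hη : 0 < η)
    (hdiag : ∀ k i, η ≤ a k i i) {k s s' : ℕ} {i j : ι} (hs : s ≤ s')
    (h : η ^ s ≤ transition a k s i j) : η ^ s' ≤ transition a k s' i j := by
  induction s', hs using Nat.le_induction with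
  | base => exact h
  | succ s' _ ih =>
    refine le_trans ?_ (mul_le_transition_succ ha k s' i i j)
    rw [pow_succ']
    exact mul_le_mul (hdiag _ _) ih (by positivity) (ha _ _ _)

/-- Under bounded intercommunication intervals, every entry of a sufficiently long product of
weight matrices is bounded below, uniformly in the starting time. -/
theorem exists_pow_le_transition (ha : ∀ k i j, 0 ≤ a k i j) {η : ℝ} (hη : 0 < η)
    (hdiag : ∀ k i, η ≤ a k i i) (heta : ∀ k i j, 0 < a k i j → η ≤ a k i j)
    {r : ι → ι → Prop} (hconn : ∀ u v, Relation.ReflTransGen r u v) {T : ℕ}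
    (hT : ∀ j i, r j i → ∀ k, ∃ l, k ≤ l ∧ l < k + T ∧ 0 < a l i j) :
    ∃ B, ∀ k i j, η ^ B ≤ transition a k B i j := by
  have hpair : ∀ u v, ∃ N, ∀ k, η ^ N ≤ transition a k N v u := by
    intro u v
    induction hconn u v with
    | refl => exact ⟨0, fun k => by simp [transition]⟩
    | @tail v w _ hvw ih =>
      obtain ⟨N, hN⟩ := ih
      refine ⟨N + T, fun k => ?_⟩
      obtain ⟨l, hl1, hl2, hl⟩ := hT v w hvw (k + N)
      obtain ⟨s, rfl⟩ := Nat.exists_eq_add_of_le (show k ≤ l by omega)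
      have hs := pow_le_transition_of_le ha hη hdiag (show N ≤ s by omega) (hN k)
      refine pow_le_transition_of_le ha hη hdiag (show s + 1 ≤ N + T by omega) ?_
      refine le_trans ?_ (mul_le_transition_succ ha k s w v u)
      rw [pow_succ']
      exact mul_le_mul (heta _ _ _ hl) hs (by positivity) (ha _ _ _)
  choose N hN using hpair
  refine ⟨∑ u, ∑ v, N u v, fun k i j => pow_le_transition_of_le ha hη hdiag ?_ (hN j i k)⟩
  exact (single_le_sum (f := fun v => N j v) (fun _ _ => Nat.zero_le _) (mem_univ i)).trans
    (single_le_sum (f := fun u => ∑ v, N u v) (fun _ _ => Nat.zero_le _) (mem_univ j))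

/-- Perturbations of a consensus iteration accumulate at most additively in the disagreement. -/
theorem disagreement_sub_transition_le (ha : ∀ k i j, 0 ≤ a k i j)
    (ha1 : ∀ k i, ∑ j, a k i j = 1) {x e : ℕ → ι → E}
    (hx : ∀ k, x (k + 1) = mix (a k) (x k) + e k) (k s : ℕ) :
    disagreement (x (k + s) - mix (transition a k s) (x k))
      ≤ ∑ r ∈ range s, disagreement (e (k + r)) := by
  induction s with
  | zero => simp [transition, mix_one, disagreement, ← Pi.zero_def]
  | succ s ih =>
    have h : x (k + (s + 1)) - mix (transition a k (s + 1)) (x k)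
        = mix (a (k + s)) (x (k + s) - mix (transition a k s) (x k)) + e (k + s) := by
      rw [← add_assoc, hx, transition, mix_mul, mix_sub]; abel
    rw [h, sum_range_succ]
    refine (disagreement_add_le _ _).trans (add_le_add_left ?_ _)
    exact (disagreement_mix_le_self (ha _) (ha1 _) _).trans ih

theorem disagreement_add_steps_le (ha : ∀ k i j, 0 ≤ a k i j)
    (ha1 : ∀ k i, ∑ j, a k i j = 1) {x e : ℕ → ι → E}
    (hx : ∀ k, x (k + 1) = mix (a k) (x k) + e k) {B : ℕ} {δ : ℝ}
    (hB : ∀ k i j, δ ≤ transition a k B i j) (k : ℕ) :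
    disagreement (x (k + B)) ≤ (1 - Fintype.card ι * δ) * disagreement (x k)
      + ∑ r ∈ range B, disagreement (e (k + r)) := by
  have h := disagreement_add_le (mix (transition a k B) (x k))
    (x (k + B) - mix (transition a k B) (x k))
  rw [add_sub_cancel] at h
  exact h.trans (add_le_add (disagreement_mix_le (hB k) (transition_row_sum ha1 k B) _)
    (disagreement_sub_transition_le ha ha1 hx k B))

end Mixing

/-- Discounting a delayed contraction with a nonincreasing weight. -/
theorem exists_sum_mul_succ_le {c d g : ℕ → ℝ} (hc0 : ∀ k, 0 ≤ c k) (hc : Antitone c)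
    (hd0 : ∀ k, 0 ≤ d k) (hg0 : ∀ k, 0 ≤ g k) {B : ℕ} {q : ℝ} (hq0 : 0 ≤ q) (hq : q < 1)
    (h : ∀ k, d (k + B) ≤ q * d k + ∑ r ∈ range B, g (k + r)) :
    ∃ K K' : ℝ, ∀ N, ∑ k ∈ range N, c k * d (k + 1)
      ≤ K + K' * ∑ k ∈ range N, c k * g k := by
  set S : ℕ → ℝ := fun N => ∑ k ∈ range N, c k * d (k + 1) with hS
  set H : ℕ → ℝ := fun N => ∑ k ∈ range N, c k * g k with hH
  have hSmono : Monotone S := fun i j hij =>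
    sum_le_sum_of_subset_of_nonneg (range_mono hij) fun k _ _ => mul_nonneg (hc0 k) (hd0 _)
  have hHmono : Monotone H := fun i j hij =>
    sum_le_sum_of_subset_of_nonneg (range_mono hij) fun k _ _ => mul_nonneg (hc0 k) (hg0 _)
  have hH0 : ∀ N, 0 ≤ H N := fun N => sum_nonneg fun k _ => mul_nonneg (hc0 k) (hg0 k)
  have hterm : ∀ k, c (B + k) * d (B + k + 1)
      ≤ q * (c k * d (k + 1)) + ∑ r ∈ range B, c (r + 1 + k) * g (r + 1 + k) := by
    intro k
    have h1 := mul_le_mul_of_nonneg_left (h (k + 1)) (hc0 (B + k))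
    rw [show k + 1 + B = B + k + 1 by ring, mul_add, mul_sum] at h1
    refine h1.trans (add_le_add ?_ (sum_le_sum fun r hr => ?_))
    · rw [mul_left_comm]
      exact mul_le_mul_of_nonneg_left
        (mul_le_mul_of_nonneg_right (hc (Nat.le_add_left _ _)) (hd0 _)) hq0
    · rw [show k + 1 + r = r + 1 + k by ring]
      have := mem_range.1 hr
      exact mul_le_mul_of_nonneg_right (hc (by omega)) (hg0 _)
  have hshift : ∀ N, S (B + N) ≤ S B + q * S N + B * H (B + N) := by
    intro N
    have h1 : ∑ k ∈ range N, ∑ r ∈ range B, c (r + 1 + k) * g (r + 1 + k) ≤ B * H (B + N) := by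
      rw [sum_comm]
      have : ∀ r ∈ range B, ∑ k ∈ range N, c (r + 1 + k) * g (r + 1 + k) ≤ H (B + N) := by
        intro r hr
        have hr := mem_range.1 hr
        have h2 : H (r + 1 + N) = H (r + 1) + ∑ k ∈ range N, c (r + 1 + k) * g (r + 1 + k) :=
          sum_range_add _ _ _
        have := hHmono (show r + 1 + N ≤ B + N by omega)
        linarith [hH0 (r + 1)]
      simpa using sum_le_card_nsmul _ _ _ this
    have h2 : S (B + N) = S B + ∑ k ∈ range N, c (B + k) * d (B + k + 1) := sum_range_add _ _ _
    have h3 := sum_le_sum fun k (_ : k ∈ range N) => hterm k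
    rw [sum_add_distrib, ← mul_sum] at h3
    linarith
  have hq1 : 0 < 1 - q := sub_pos.2 hq
  have hSB : 0 ≤ S B := sum_nonneg fun k _ => mul_nonneg (hc0 k) (hd0 _)
  refine ⟨S B / (1 - q), B / (1 - q), fun N => ?_⟩
  rw [div_mul_eq_mul_div, ← add_div, le_div_iff₀ hq1]
  rcases le_total N B with hN | hN
  · have h1 := hSmono hN
    have h0 : 0 ≤ S N := sum_nonneg fun k _ => mul_nonneg (hc0 k) (hd0 _)
    nlinarith [mul_nonneg (Nat.cast_nonneg (α := ℝ) B) (hH0 N)]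
  · obtain ⟨M, rfl⟩ := Nat.exists_eq_add_of_le hN
    have h1 := hshift M
    have h2 := mul_le_mul_of_nonneg_left (hSmono (Nat.le_add_left M B)) hq0
    change S (B + M) * (1 - q) ≤ S B + B * H (B + M)
    linarith

/-- Summability of a dissipation term `E` whose driving term is bounded by `c k * d (k + 1)`. -/
theorem summable_of_dissipation {V E c d g : ℕ → ℝ} (hV0 : ∀ k, 0 ≤ V k) (hE0 : ∀ k, 0 ≤ E k)
    {C : ℝ} (hC : 0 ≤ C) (hc_sq : Summable fun k => c k ^ 2)
    (hV : ∀ k, V (k + 1) ≤ V k - E k + C * (c k * d (k + 1)))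
    (hgE : ∀ k, g k ^ 2 ≤ 4 * E k) {K K' : ℝ}
    (hS : ∀ N, ∑ k ∈ range N, c k * d (k + 1) ≤ K + K' * ∑ k ∈ range N, c k * g k) :
    Summable E := by
  refine summable_of_sum_range_le (c := 2 * (V 0 + C * K) + 4 * (C * K') ^ 2 * ∑' k, c k ^ 2)
    hE0 fun N => ?_
  have htel : V N + ∑ k ∈ range N, E k ≤ V 0 + C * ∑ k ∈ range N, c k * d (k + 1) := by
    induction N with
    | zero => simp
    | succ N ih => rw [sum_range_succ, sum_range_succ, mul_add]; linarith [hV N]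
  have hyoung : C * K' * ∑ k ∈ range N, c k * g k
      ≤ 2 * (C * K') ^ 2 * ∑ k ∈ range N, c k ^ 2 + (1 / 2) * ∑ k ∈ range N, E k := by
    rw [mul_sum, mul_sum, mul_sum, ← sum_add_distrib]
    refine sum_le_sum fun k _ => ?_
    nlinarith [sq_nonneg (4 * (C * K') * c k - g k), hgE k]
  have hcs : ∑ k ∈ range N, c k ^ 2 ≤ ∑' k, c k ^ 2 :=
    hc_sq.sum_le_tsum _ fun k _ => sq_nonneg _
  have h1 := mul_le_mul_of_nonneg_left (hS N) hC
  have h2 := mul_le_mul_of_nonneg_left hcs (by positivity : 0 ≤ 2 * (C * K') ^ 2)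
  linarith [hV0 N]

theorem stmt2
    (n m : ℕ) (hm : 2 ≤ m)
    (X : Fin m → Set (EuclideanSpace ℝ (Fin n)))
    (hXne : ∀ i, (X i).Nonempty)
    (hXcpt : ∀ i, IsCompact (X i))
    (hXconv : ∀ i, Convex ℝ (X i))
    (f : Fin m → EuclideanSpace ℝ (Fin n) → ℝ)
    (hfconv : ∀ i, ConvexOn ℝ Set.univ (f i))
    (xbar : EuclideanSpace ℝ (Fin n)) (ρ : ℝ) (hρ : 0 < ρ)
    (hball : Metric.ball xbar ρ ⊆ ⋂ i, X i)
    (Xstar : Set (EuclideanSpace ℝ (Fin n)))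
    (hXstar : Xstar = {p | p ∈ ⋂ i, X i ∧ ∀ y ∈ ⋂ i, X i, ∑ i, f i p ≤ ∑ i, f i y})
    (hXstar_ne : Xstar.Nonempty)
    (a : ℕ → Fin m → Fin m → ℝ)
    (ha_nonneg : ∀ k i j, 0 ≤ a k i j)
    (ha_row : ∀ k i, ∑ j, a k i j = 1)
    (ha_col : ∀ k j, ∑ i, a k i j = 1)
    (η : ℝ) (hη : η ∈ Set.Ioo (0:ℝ) 1)
    (ha_diag : ∀ k i, η ≤ a k i i)
    (ha_eta : ∀ k i j, 0 < a k i j → η ≤ a k i j)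
    (hconn : ∀ u v : Fin m,
      Relation.ReflTransGen (fun p1 p2 => {k : ℕ | 0 < a k p2 p1}.Infinite) u v)
    (T : ℕ) (hT : 1 ≤ T)
    (hTcomm : ∀ j i : Fin m, {k : ℕ | 0 < a k i j}.Infinite →
      ∀ k : ℕ, ∃ l, k ≤ l ∧ l < k + T ∧ 0 < a l i j)
    (c : ℕ → ℝ) (hc_pos : ∀ k, 0 < c k) (hc_anti : Antitone c)
    (hc_div : Tendsto (fun N => ∑ k ∈ Finset.range N, c k) atTop atTop)
    (hc_sq : Summable (fun k => (c k)^2))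
    (x : Fin m → ℕ → EuclideanSpace ℝ (Fin n))
    (hx0 : ∀ i, x i 0 ∈ X i)
    (z : Fin m → ℕ → EuclideanSpace ℝ (Fin n))
    (hz : ∀ i k, z i k = ∑ j, a k i j • x j k)
    (hupd_mem : ∀ i k, x i (k+1) ∈ X i)
    (hupd_min : ∀ i k, ∀ y ∈ X i,
      f i (x i (k+1)) + (1/(2 * c k)) * ‖z i k - x i (k+1)‖^2
        ≤ f i y + (1/(2 * c k)) * ‖z i k - y‖^2)
    (hupd_uniq : ∀ i k, ∀ y ∈ X i,
      f i y + (1/(2 * c k)) * ‖z i k - y‖^2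
        = f i (x i (k+1)) + (1/(2 * c k)) * ‖z i k - x i (k+1)‖^2 → y = x i (k+1))
    (e : Fin m → ℕ → EuclideanSpace ℝ (Fin n))
    (he : ∀ i k, e i (k + 1) = x i (k + 1) - z i k) :
    Summable (fun k : ℕ => ∑ i, ‖e i (k + 1)‖^2) ∧
    ∀ i, Tendsto (fun k : ℕ => ‖e i (k + 1)‖) atTop (𝓝 0) := by
  have : Nonempty (Fin m) := ⟨⟨0, by omega⟩⟩
  obtain ⟨hη0, hη1⟩ := hη
  let xs : ℕ → Fin m → EuclideanSpace ℝ (Fin n) := fun k i => x i k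
  let es : ℕ → Fin m → EuclideanSpace ℝ (Fin n) := fun k i => e i (k + 1)
  have hxX : ∀ k i, x i k ∈ X i := fun k i => by
    cases k with
    | zero => exact hx0 i
    | succ k => exact hupd_mem i k
  have hstep : ∀ k, xs (k + 1) = mix (a k) (xs k) + es k := fun k => by
    ext1 i
    simp only [xs, es, mix, Pi.add_apply, he, ← hz]
    abel
  -- geometric decay of the disagreement up to the errors
  obtain ⟨B, hB⟩ := exists_pow_le_transition (a := a) ha_nonneg hη0 ha_diag ha_eta hconn hTcomm
  have hcard : (Fintype.card (Fin m) : ℝ) * η ^ B ≤ 1 := by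
    have h := sum_le_sum fun j (_ : j ∈ univ) => hB 0 (Classical.arbitrary (Fin m)) j
    rw [transition_row_sum ha_row] at h
    simpa using h
  have hcard0 : 0 < (Fintype.card (Fin m) : ℝ) * η ^ B := by
    have := Fintype.card_pos (α := Fin m)
    positivity
  obtain ⟨K, K', hK⟩ := exists_sum_mul_succ_le (fun k => (hc_pos k).le) hc_anti
    (fun k => disagreement_nonneg (xs k)) (fun k => disagreement_nonneg (es k))
    (sub_nonneg.2 hcard) (sub_lt_self 1 hcard0)
    (disagreement_add_steps_le ha_nonneg ha_row hstep hB)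
  have hLip : ∀ i, ∃ L : NNReal, LipschitzOnWith L (f i) (X i) := fun i =>
    (hfconv i).locallyLipschitz.locallyLipschitzOn.exists_lipschitzOnWith_of_compact (hXcpt i)
  choose L hL using hLip
  have hbdd : ∀ i, ∃ R : ℝ, ∀ p ∈ X i, ‖xbar - p‖ ≤ R := fun i => by
    obtain ⟨R, hR⟩ := (hXcpt i).isBounded.subset_closedBall xbar
    exact ⟨R, fun p hp => by simpa [dist_eq_norm, norm_sub_rev] using hR hp⟩
  choose R hR using hbdd
  let i₀ : Fin m := Classical.arbitrary _
  have hR0 : 0 ≤ R i₀ := (norm_nonneg _).trans (hR i₀ _ (hx0 i₀))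
  have hball' : Metric.closedBall xbar (ρ / 2) ⊆ ⋂ i, X i :=
    (Metric.closedBall_subset_ball (by linarith)).trans hball
  obtain ⟨p, hp⟩ := hXstar_ne
  rw [hXstar] at hp
  obtain ⟨hpX, hpmin⟩ := hp
  let M : ℝ := R i₀ / (ρ / 2) + 1
  have hM : 0 ≤ M := by positivity
  have hgap : ∀ k, ∑ i, (f i p - f i (x i k)) ≤ (∑ i, (L i : ℝ) * M) * disagreement (xs k) := by
    intro k
    obtain ⟨s, hsX, hs⟩ := exists_mem_iInter_norm_sub_le hXconv (half_pos hρ) hball' (hxX k)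
      (disagreement_nonneg (xs k)) (fun i => norm_sub_le_disagreement (xs k) i₀ i)
    have hsi : ∀ i, ‖s - x i k‖ ≤ M * disagreement (xs k) := fun i => by
      calc ‖s - x i k‖ ≤ ‖s - x i₀ k‖ + ‖x i₀ k - x i k‖ := norm_sub_le_norm_sub_add_norm_sub _ _ _
        _ ≤ disagreement (xs k) / (ρ / 2) * R i₀ + disagreement (xs k) := by
            refine add_le_add (hs.trans ?_) (norm_sub_le_disagreement (xs k) i₀ i)
            exact mul_le_mul_of_nonneg_left (hR i₀ _ (hxX k i₀))
              (div_nonneg (disagreement_nonneg _) (half_pos hρ).le)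
        _ = M * disagreement (xs k) := by simp only [M]; ring
    have hmin := hpmin s hsX
    calc ∑ i, (f i p - f i (x i k)) ≤ ∑ i, (f i s - f i (x i k)) := by
          simp only [sum_sub_distrib]; linarith
      _ ≤ ∑ i, (L i : ℝ) * M * disagreement (xs k) := by
          refine sum_le_sum fun i _ => ?_
          have h := (hL i).norm_sub_le (Set.mem_iInter.1 hsX i) (hxX k i)
          calc f i s - f i (x i k) ≤ ‖f i s - f i (x i k)‖ := Real.le_norm_self _
            _ ≤ L i * ‖s - x i k‖ := h
            _ ≤ L i * (M * disagreement (xs k)) :=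
                mul_le_mul_of_nonneg_left (hsi i) (L i).coe_nonneg
            _ = _ := by ring
      _ = _ := by rw [sum_mul]
  -- the Lyapunov inequality
  have hV : ∀ k, ∑ i, ‖x i (k + 1) - p‖ ^ 2 ≤ ∑ i, ‖x i k - p‖ ^ 2 - ∑ i, ‖e i (k + 1)‖ ^ 2
      + (2 * ∑ i, (L i : ℝ) * M) * (c k * disagreement (xs (k + 1))) := by
    intro k
    have h1 := sum_le_sum fun i (_ : i ∈ univ) =>
      prox_three_point (hXconv i) (hfconv i) (hc_pos k) (hupd_mem i k)
        (Set.mem_iInter.1 hpX i) (hupd_min i k)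
    rw [sum_add_distrib, sum_sub_distrib, ← mul_sum] at h1
    have h2 : ∑ i, ‖z i k - p‖ ^ 2 ≤ ∑ j, ‖x j k - p‖ ^ 2 := by
      calc ∑ i, ‖z i k - p‖ ^ 2 ≤ ∑ i, ∑ j, a k i j * ‖x j k - p‖ ^ 2 :=
            sum_le_sum fun i _ => by
              rw [hz]; exact norm_sum_smul_sub_sq_le (ha_nonneg k i) (ha_row k i) _ _
        _ = ∑ j, ‖x j k - p‖ ^ 2 := by
            rw [sum_comm]; simp [← sum_mul, ha_col]
    have h3 := mul_le_mul_of_nonneg_left (hgap (k + 1)) (by linarith [hc_pos k] : 0 ≤ 2 * c k)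
    simp only [he]
    linarith
  have hsum : Summable (fun k : ℕ => ∑ i, ‖e i (k + 1)‖ ^ 2) :=
    summable_of_dissipation (V := fun k => ∑ i, ‖x i k - p‖ ^ 2)
      (d := fun k => disagreement (xs k)) (g := fun k => disagreement (es k))
      (fun k => sum_nonneg fun i _ => sq_nonneg _) (fun k => sum_nonneg fun i _ => sq_nonneg _)
      (mul_nonneg zero_le_two (sum_nonneg fun i _ => mul_nonneg (L i).coe_nonneg hM)) hc_sq hV
      (fun k => disagreement_sq_le (es k)) hK
  refine ⟨hsum, fun i => ?_⟩
  have hsq : Tendsto (fun k : ℕ => ‖e i (k + 1)‖ ^ 2) atTop (𝓝 0) :=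
    squeeze_zero (fun k => sq_nonneg _)
      (fun k => single_le_sum (f := fun i => ‖e i (k + 1)‖ ^ 2) (fun i _ => sq_nonneg _)
        (mem_univ i)) hsum.tendsto_atTop_zero
  simpa [Real.sqrt_sq] using hsq.sqrt
end

section
/- Under the full assumptions and Algorithm 1, with v(k) = (1/m)∑_{i=1}^m x_i(k), there holds lim_{k→∞} ‖x_i(k) − v(k)‖ = 0 for every i = 1,…,m, i.e., each agent's iterate asymptotically tracks the arithmetic average of all agents' iterates. -/
open Filter Finset Metric
open scoped Topology BigOperators

section Proximal

variable {E : Type*} [NormedAddCommGroup E] [InnerProductSpace ℝ E]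

/-- Three-point inequality for a minimizer `p` of `f + ‖z - ·‖² / (2c)` over a convex set. -/
theorem proximal_three_point {S : Set E} (hS : Convex ℝ S) {f : E → ℝ}
    (hf : ConvexOn ℝ Set.univ f) {c : ℝ} (hc : 0 < c) {z p : E} (hp : p ∈ S)
    (hmin : ∀ y ∈ S, f p + (1 / (2 * c)) * ‖z - p‖ ^ 2 ≤ f y + (1 / (2 * c)) * ‖z - y‖ ^ 2)
    {y : E} (hy : y ∈ S) :
    ‖p - y‖ ^ 2 + ‖p - z‖ ^ 2 ≤ ‖z - y‖ ^ 2 + 2 * c * (f y - f p) := by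
  have hyz : ‖z - y‖ ^ 2 = ‖p - z‖ ^ 2 + ‖p - y‖ ^ 2 - 2 * inner ℝ (z - p) (y - p) := by
    have h := norm_sub_sq_real (z - p) (y - p)
    rw [sub_sub_sub_cancel_right, norm_sub_rev z p, norm_sub_rev y p] at h
    linarith
  have key : ∀ t ∈ Set.Ioo (0 : ℝ) 1,
      2 * c * (f p - f y) + 2 * inner ℝ (z - p) (y - p) ≤ t * ‖y - p‖ ^ 2 := by
    rintro t ⟨ht0, ht1⟩
    have hconv : f ((1 - t) • p + t • y) ≤ (1 - t) * f p + t * f y := by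
      simpa using hf.2 (Set.mem_univ p) (Set.mem_univ y) (by linarith : 0 ≤ 1 - t) ht0.le (by ring)
    have hmem : (1 - t) • p + t • y ∈ S := hS hp hy (by linarith) ht0.le (by ring)
    have hnorm : ‖z - ((1 - t) • p + t • y)‖ ^ 2
        = ‖z - p‖ ^ 2 - 2 * (t * inner ℝ (z - p) (y - p)) + t ^ 2 * ‖y - p‖ ^ 2 := by
      have : z - ((1 - t) • p + t • y) = (z - p) - t • (y - p) := by module
      rw [this, norm_sub_sq_real, inner_smul_right, norm_smul, mul_pow, Real.norm_eq_abs, sq_abs]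
    have h := hmin _ hmem
    rw [hnorm] at h
    have h1 : t * (f p - f y) ≤
        (1 / (2 * c)) * (t ^ 2 * ‖y - p‖ ^ 2 - 2 * (t * inner ℝ (z - p) (y - p))) := by
      linarith
    rw [one_div_mul_eq_div, le_div_iff₀ (by positivity)] at h1
    refine le_of_mul_le_mul_left ?_ ht0
    linarith
  have hlim : 2 * c * (f p - f y) + 2 * inner ℝ (z - p) (y - p) ≤ 0 := by
    have ht : Tendsto (fun t : ℝ => t * ‖y - p‖ ^ 2) (𝓝[>] 0) (𝓝 0) := by
      have : Tendsto (fun t : ℝ => t * ‖y - p‖ ^ 2) (𝓝 0) (𝓝 (0 * ‖y - p‖ ^ 2)) :=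
        tendsto_id.mul_const _
      rw [zero_mul] at this
      exact this.mono_left nhdsWithin_le_nhds
    refine ge_of_tendsto ht ?_
    filter_upwards [Ioo_mem_nhdsGT (zero_lt_one' ℝ)] with t ht using key t ht
  linarith

/-- Bias-variance decomposition for a weighted average. -/
theorem sum_weighted_norm_sub_sq {ι : Type*} [Fintype ι] {w : ι → ℝ} (hw : ∑ j, w j = 1)
    (p : ι → E) (y : E) :
    ∑ j, w j * ‖p j - y‖ ^ 2
      = ‖(∑ j, w j • p j) - y‖ ^ 2 + ∑ j, w j * ‖p j - ∑ l, w l • p l‖ ^ 2 := by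
  set z := ∑ j, w j • p j with hz
  have hcross : ∑ j, w j * inner ℝ (p j - z) (z - y) = 0 := by
    have : ∑ j, w j • (p j - z) = 0 := by
      simp only [smul_sub, sum_sub_distrib, ← sum_smul, hw, one_smul, ← hz, sub_self]
    simp only [← real_inner_smul_left, ← sum_inner, this, inner_zero_left]
  have hterm : ∀ j, w j * ‖p j - y‖ ^ 2
      = w j * ‖p j - z‖ ^ 2 + 2 * (w j * inner ℝ (p j - z) (z - y)) + w j * ‖z - y‖ ^ 2 := by
    intro j
    rw [← sub_add_sub_cancel (p j) z y, norm_add_sq_real]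
    ring
  simp only [hterm, sum_add_distrib, ← mul_sum, ← sum_mul, hcross, hw]
  ring

end Proximal

/-- Points that are pairwise close along the edges of a connected graph are pairwise close. -/
theorem exists_norm_sub_le_of_reflTransGen {ι E : Type*} [Fintype ι] [SeminormedAddCommGroup E]
    {r : ι → ι → Prop} (hr : ∀ u v, Relation.ReflTransGen r u v) :
    ∃ K : ℝ, 0 ≤ K ∧ ∀ (p : ι → E) (s : ℝ), 0 ≤ s → (∀ u v, r u v → ‖p u - p v‖ ≤ s) →
      ∀ u v, ‖p u - p v‖ ≤ K * s := by
  have h : ∀ u v, ∃ K : ℝ, 0 ≤ K ∧ ∀ (p : ι → E) (s : ℝ), 0 ≤ s →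
      (∀ u v, r u v → ‖p u - p v‖ ≤ s) → ‖p u - p v‖ ≤ K * s := by
    intro u v
    induction hr u v with
    | refl => exact ⟨0, le_rfl, by simp⟩
    | @tail b d _ hbd ih =>
      obtain ⟨K, hK, ih⟩ := ih
      refine ⟨K + 1, by positivity, fun p s hs hp => ?_⟩
      have h1 := ih p s hs hp
      have h2 := hp b d hbd
      have h3 := norm_sub_le_norm_sub_add_norm_sub (p u) (p b) (p d)
      linarith
  choose K hK hp using h
  refine ⟨∑ u, ∑ v, K u v, sum_nonneg fun u _ => sum_nonneg fun v _ => hK u v,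
    fun p s hs hps u v => (hp u v p s hs hps).trans (mul_le_mul_of_nonneg_right ?_ hs)⟩
  exact (single_le_sum (f := K u) (fun v _ => hK u v) (mem_univ v)).trans
    (single_le_sum (f := fun u => ∑ v, K u v) (fun u _ => sum_nonneg fun v _ => hK u v)
      (mem_univ u))

/-- A point within `δ` of every member of a family of convex sets that share a ball is within a
multiple of `δ` of their intersection. -/
theorem exists_mem_forall_norm_sub_le {ι E : Type*} [NormedAddCommGroup E] [NormedSpace ℝ E]
    {X : ι → Set E} (hX : ∀ i, Convex ℝ (X i)) {c : E} {ρ : ℝ} (hρ : 0 < ρ)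
    (hball : ball c ρ ⊆ ⋂ i, X i) {q : E} {p : ι → E} (hp : ∀ i, p i ∈ X i) {δ : ℝ} (hδ : 0 < δ)
    (hq : ∀ i, ‖q - p i‖ ≤ δ) :
    ∃ y ∈ ⋂ i, X i, ‖q - y‖ ≤ δ * (2 * ‖q - c‖ / ρ) := by
  have hpos : 0 < δ + ρ / 2 := by positivity
  refine ⟨(δ / (δ + ρ / 2)) • c + ((ρ / 2) / (δ + ρ / 2)) • q, ?_, ?_⟩
  · refine Set.mem_iInter.2 fun i => ?_
    have hb : c + ((ρ / 2) / δ) • (q - p i) ∈ X i := by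
      refine Set.mem_iInter.1 (hball ?_) i
      rw [mem_ball_iff_norm, add_sub_cancel_left, norm_smul, Real.norm_of_nonneg (by positivity)]
      calc ρ / 2 / δ * ‖q - p i‖ ≤ ρ / 2 / δ * δ := by gcongr; exact hq i
        _ = ρ / 2 := by field_simp
        _ < ρ := by linarith
    have h := hX i hb (hp i) (a := δ / (δ + ρ / 2)) (b := (ρ / 2) / (δ + ρ / 2))
      (by positivity) (by positivity) (by field_simp)
    convert h using 1
    rw [smul_add, smul_smul, div_mul_div_comm, mul_comm δ, mul_div_mul_right _ _ hδ.ne']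
    module
  · have : q - ((δ / (δ + ρ / 2)) • c + ((ρ / 2) / (δ + ρ / 2)) • q)
        = (δ / (δ + ρ / 2)) • (q - c) := by
      have h1 : (ρ / 2) / (δ + ρ / 2) = 1 - δ / (δ + ρ / 2) := by field_simp; ring
      rw [h1]; module
    rw [this, norm_smul, Real.norm_of_nonneg (by positivity)]
    calc δ / (δ + ρ / 2) * ‖q - c‖ ≤ δ / (ρ / 2) * ‖q - c‖ := by gcongr; linarith
      _ = δ * (2 * ‖q - c‖ / ρ) := by field_simp

/-- If a nonnegative sequence has drift at most `g` with decrease `P`, then every window of a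
fixed length starting where `g` is small contains a block of `T` steps during which `P` is small. -/
theorem exists_block_le_of_drift {W P g : ℕ → ℝ} {B : ℝ} (hW : ∀ k, 0 ≤ W k) (hWB : ∀ k, W k ≤ B)
    (hP : ∀ k, 0 ≤ P k) (hdrift : ∀ k, W (k + 1) + P k ≤ W k + g k) (hg : Antitone g)
    (T : ℕ) {σ : ℝ} (hσ : 0 < σ) :
    ∃ L : ℕ, ∀ k, T * g k ≤ σ / 2 →
      ∃ l, k ≤ l ∧ l ≤ k + L ∧ ∀ t < T, P (l + t) ≤ σ := by
  obtain ⟨N, hN⟩ := exists_nat_gt (2 * B / σ)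
  have hNσ : B < N * (σ / 2) := by
    rw [div_lt_iff₀ hσ] at hN; linarith
  refine ⟨N * T, fun k hk => ?_⟩
  by_contra! hcon
  have hblock : ∀ l t, k ≤ l → W (l + t) + ∑ s ∈ range t, P (l + s) ≤ W l + t * g k := by
    intro l t hl
    induction t with
    | zero => simp
    | succ t ih =>
      have h1 := hdrift (l + t)
      have h2 := hg (show k ≤ l + t by omega)
      rw [sum_range_succ, ← add_assoc, ← add_assoc l t 1]
      push_cast
      linarith
  have hiter : ∀ j ≤ N, W (k + j * T) ≤ W k - j * (σ / 2) := by
    intro j hj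
    induction j with
    | zero => simp
    | succ j ih =>
      obtain ⟨t, ht, hPt⟩ := hcon (k + j * T) (by omega)
        (by have := Nat.mul_le_mul_right T (show j ≤ N by omega); omega)
      have h1 := hblock (k + j * T) T (by omega)
      have h2 : P (k + j * T + t) ≤ ∑ s ∈ range T, P (k + j * T + s) :=
        single_le_sum (f := fun s => P (k + j * T + s)) (fun s _ => hP _) (mem_range.2 ht)
      have h3 := ih (by omega)
      rw [show k + (j + 1) * T = k + j * T + T by ring]
      push_cast
      linarith
  have h1 := hiter N le_rfl
  have h2 := hW (k + N * T)
  have h3 := hWB k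
  linarith

section Consensus

variable {ι E : Type*} [NormedAddCommGroup E]

/-- One averaging step moves every point, and separates communicating points, by at most a multiple
of the square root of the Lyapunov decrease. -/
theorem norm_sub_le_of_weighted_deviation_le [Fintype ι] {w : ι → ι → ℝ} {η σ : ℝ} (hη : 0 < η) (hη1 : η ≤ 1)
    (hw : ∀ i j, 0 ≤ w i j) (hdiag : ∀ i, η ≤ w i i) (hpos : ∀ i j, 0 < w i j → η ≤ w i j)
    {p p' z : ι → E}
    (hdev : ∑ i, (‖p' i - z i‖ ^ 2 + ∑ j, w i j * ‖p j - z i‖ ^ 2) ≤ σ) :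
    (∀ i, ‖p' i - p i‖ ≤ 2 * √(σ / η)) ∧
      ∀ i j, 0 < w i j → ‖p i - p j‖ ≤ 2 * √(σ / η) := by
  have hin : ∀ i, 0 ≤ ∑ j, w i j * ‖p j - z i‖ ^ 2 := fun i =>
    sum_nonneg fun j _ => mul_nonneg (hw i j) (sq_nonneg _)
  have hrow : ∀ i, ‖p' i - z i‖ ^ 2 + ∑ j, w i j * ‖p j - z i‖ ^ 2 ≤ σ := fun i =>
    (single_le_sum (f := fun i => ‖p' i - z i‖ ^ 2 + ∑ j, w i j * ‖p j - z i‖ ^ 2)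
      (fun i _ => add_nonneg (sq_nonneg _) (hin i)) (mem_univ i)).trans hdev
  have hstep : ∀ i, ‖p' i - z i‖ ≤ √(σ / η) := by
    intro i
    refine Real.le_sqrt_of_sq_le ?_
    rw [le_div_iff₀ hη]
    have h1 := hrow i
    have h2 := hin i
    have h3 := mul_le_mul_of_nonneg_left hη1 (sq_nonneg ‖p' i - z i‖)
    linarith
  have hedge : ∀ i j, 0 < w i j → ‖p j - z i‖ ≤ √(σ / η) := by
    intro i j hij
    refine Real.le_sqrt_of_sq_le ?_
    rw [le_div_iff₀ hη]
    have h1 := hrow i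
    have h2 := single_le_sum (f := fun j => w i j * ‖p j - z i‖ ^ 2)
      (fun j _ => mul_nonneg (hw i j) (sq_nonneg _)) (mem_univ j)
    have h3 := mul_le_mul_of_nonneg_right (hpos i j hij) (sq_nonneg ‖p j - z i‖)
    have h4 := sq_nonneg ‖p' i - z i‖
    linarith
  have hself : ∀ i, ‖p i - z i‖ ≤ √(σ / η) := fun i => hedge i i (hη.trans_le (hdiag i))
  refine ⟨fun i => ?_, fun i j hij => ?_⟩
  · have h := norm_sub_le_norm_sub_add_norm_sub (p' i) (z i) (p i)
    rw [norm_sub_rev (z i)] at h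
    linarith [hstep i, hself i]
  · have h := norm_sub_le_norm_sub_add_norm_sub (p i) (z i) (p j)
    rw [norm_sub_rev (z i)] at h
    linarith [hself i, hedge i j hij]

/-- If over `T` steps every point moves by at most `s` per step and two of the points are within `s`
at some step, then they are within `(2 * T + 1) * s` at the start. -/
theorem norm_sub_le_of_small_steps {x : ι → ℕ → E} {k T : ℕ} {s : ℝ}
    (hstep : ∀ t < T, ∀ i, ‖x i (k + t + 1) - x i (k + t)‖ ≤ s) {i j : ι} {t : ℕ} (ht : t < T)
    (hij : ‖x i (k + t) - x j (k + t)‖ ≤ s) : ‖x i k - x j k‖ ≤ (2 * T + 1) * s := by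
  have hmove : ∀ u ≤ T, ∀ i, ‖x i (k + u) - x i k‖ ≤ u * s := by
    intro u hu i
    induction u with
    | zero => simp
    | succ u ih =>
      have h1 := hstep u (by omega) i
      have h2 := ih (by omega)
      have h3 := norm_sub_le_norm_sub_add_norm_sub (x i (k + u + 1)) (x i (k + u)) (x i k)
      rw [← add_assoc]
      push_cast
      linarith
  have hs : 0 ≤ s := (norm_nonneg _).trans hij
  have htT : (t : ℝ) * s ≤ T * s := by gcongr
  have h1 := hmove t ht.le i
  have h2 := hmove t ht.le j
  have h3 := norm_sub_le_norm_sub_add_norm_sub (x i k) (x i (k + t)) (x j k)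
  have h4 := norm_sub_le_norm_sub_add_norm_sub (x i (k + t)) (x j (k + t)) (x j k)
  rw [norm_sub_rev (x i k) (x i (k + t))] at h3
  linarith

/-- The mean of finitely many points of a ball lies in that ball. -/
theorem norm_mean_sub_le [Fintype ι] [Nonempty ι] [NormedSpace ℝ E] {p : ι → E} {y : E} {r : ℝ}
    (hp : ∀ i, ‖p i - y‖ ≤ r) : ‖(Fintype.card ι : ℝ)⁻¹ • ∑ i, p i - y‖ ≤ r := by
  have hcard : (0 : ℝ) < Fintype.card ι := by exact_mod_cast Fintype.card_pos
  have h : (Fintype.card ι : ℝ)⁻¹ • ∑ i, p i - y = (Fintype.card ι : ℝ)⁻¹ • ∑ i, (p i - y) := by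
    rw [sum_sub_distrib, smul_sub, sum_const, card_univ, ← Nat.cast_smul_eq_nsmul ℝ,
      inv_smul_smul₀ hcard.ne']
  rw [h, norm_smul, norm_inv, Real.norm_natCast, inv_mul_le_iff₀ hcard]
  refine (norm_sum_le_of_le _ fun i _ => hp i).trans ?_
  simp

end Consensus

theorem stmt3
    (n m : ℕ) (hm : 2 ≤ m)
    (X : Fin m → Set (EuclideanSpace ℝ (Fin n)))
    (hXne : ∀ i, (X i).Nonempty)
    (hXcpt : ∀ i, IsCompact (X i))
    (hXconv : ∀ i, Convex ℝ (X i))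
    (f : Fin m → EuclideanSpace ℝ (Fin n) → ℝ)
    (hfconv : ∀ i, ConvexOn ℝ Set.univ (f i))
    (xbar : EuclideanSpace ℝ (Fin n)) (ρ : ℝ) (hρ : 0 < ρ)
    (hball : Metric.ball xbar ρ ⊆ ⋂ i, X i)
    (a : ℕ → Fin m → Fin m → ℝ)
    (ha_nonneg : ∀ k i j, 0 ≤ a k i j)
    (ha_row : ∀ k i, ∑ j, a k i j = 1)
    (ha_col : ∀ k j, ∑ i, a k i j = 1)
    (η : ℝ) (hη : η ∈ Set.Ioo (0:ℝ) 1)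
    (ha_diag : ∀ k i, η ≤ a k i i)
    (ha_eta : ∀ k i j, 0 < a k i j → η ≤ a k i j)
    (hconn : ∀ u v : Fin m,
      Relation.ReflTransGen (fun p1 p2 => {k : ℕ | 0 < a k p2 p1}.Infinite) u v)
    (T : ℕ) (hT : 1 ≤ T)
    (hTcomm : ∀ j i : Fin m, {k : ℕ | 0 < a k i j}.Infinite →
      ∀ k : ℕ, ∃ l, k ≤ l ∧ l < k + T ∧ 0 < a l i j)
    (c : ℕ → ℝ) (hc_pos : ∀ k, 0 < c k) (hc_anti : Antitone c)
    (hc_div : Tendsto (fun N => ∑ k ∈ Finset.range N, c k) atTop atTop)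
    (hc_sq : Summable (fun k => (c k)^2))
    (x : Fin m → ℕ → EuclideanSpace ℝ (Fin n))
    (hx0 : ∀ i, x i 0 ∈ X i)
    (z : Fin m → ℕ → EuclideanSpace ℝ (Fin n))
    (hz : ∀ i k, z i k = ∑ j, a k i j • x j k)
    (hupd_mem : ∀ i k, x i (k+1) ∈ X i)
    (hupd_min : ∀ i k, ∀ y ∈ X i,
      f i (x i (k+1)) + (1/(2 * c k)) * ‖z i k - x i (k+1)‖^2
        ≤ f i y + (1/(2 * c k)) * ‖z i k - y‖^2)
    (hupd_uniq : ∀ i k, ∀ y ∈ X i,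
      f i y + (1/(2 * c k)) * ‖z i k - y‖^2
        = f i (x i (k+1)) + (1/(2 * c k)) * ‖z i k - x i (k+1)‖^2 → y = x i (k+1))
    (v : ℕ → EuclideanSpace ℝ (Fin n))
    (hv : ∀ k, v k = (m : ℝ)⁻¹ • ∑ i, x i k) :
    ∀ i, Tendsto (fun k => ‖x i k - v k‖) atTop (𝓝 0) := by
  have hm0 : NeZero m := ⟨by omega⟩
  obtain ⟨hη0, hη1⟩ := hη
  have hxX : ∀ i k, x i k ∈ X i := fun i k => by
    cases k with
    | zero => exact hx0 i
    | succ k => exact hupd_mem i k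
  -- Uniform bounds on the objectives and on the constraint sets.
  have hfbd : ∀ i, ∃ M : ℝ, ∀ y ∈ X i, |f i y| ≤ M := fun i =>
    (hXcpt i).exists_bound_of_continuousOn (f := f i)
      (((hfconv i).continuousOn isOpen_univ).mono (Set.subset_univ _))
  choose M hM using hfbd
  have hXbd : ∀ i, ∃ R : ℝ, ∀ y ∈ X i, ‖y - xbar‖ ≤ R := fun i =>
    (hXcpt i).exists_bound_of_continuousOn (continuous_id.sub continuous_const).continuousOn
  choose R hR using hXbd
  set C : ℝ := ∑ i, 4 * M i with hC
  have hM0 : ∀ i, 0 ≤ M i := fun i => (abs_nonneg _).trans (hM i _ (hxX i 0))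
  have hC0 : 0 ≤ C := sum_nonneg fun i _ => by have := hM0 i; positivity
  -- Lyapunov inequality towards any feasible point.
  set P : ℕ → ℝ := fun k =>
    ∑ i, (‖x i (k + 1) - z i k‖ ^ 2 + ∑ j, a k i j * ‖x j k - z i k‖ ^ 2) with hPdef
  have hP : ∀ k, 0 ≤ P k := fun k => sum_nonneg fun i _ => add_nonneg (sq_nonneg _)
    (sum_nonneg fun j _ => mul_nonneg (ha_nonneg k i j) (sq_nonneg _))
  have hdrift : ∀ y ∈ ⋂ i, X i, ∀ k,
      ∑ i, ‖x i (k + 1) - y‖ ^ 2 + P k ≤ ∑ i, ‖x i k - y‖ ^ 2 + C * c k := by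
    intro y hy k
    have hi : ∀ i, ‖x i (k + 1) - y‖ ^ 2
        + (‖x i (k + 1) - z i k‖ ^ 2 + ∑ j, a k i j * ‖x j k - z i k‖ ^ 2)
        ≤ ∑ j, a k i j * ‖x j k - y‖ ^ 2 + 4 * M i * c k := by
      intro i
      have hyi := Set.mem_iInter.1 hy i
      have h1 := proximal_three_point (hXconv i) (hfconv i) (hc_pos k) (hupd_mem i k)
        (hupd_min i k) hyi
      have h2 := sum_weighted_norm_sub_sq (ha_row k i) (fun j => x j k) y
      rw [← hz i k] at h2
      have h3 := (abs_le.1 (hM i y hyi)).2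
      have h4 := (abs_le.1 (hM i _ (hupd_mem i k))).1
      have h5 : c k * (f i y - f i (x i (k + 1))) ≤ c k * (2 * M i) :=
        mul_le_mul_of_nonneg_left (by linarith) (hc_pos k).le
      linarith
    have hsum := sum_le_sum fun i (_ : i ∈ univ) => hi i
    have hswap : ∑ i, ∑ j, a k i j * ‖x j k - y‖ ^ 2 = ∑ j, ‖x j k - y‖ ^ 2 := by
      rw [sum_comm]
      simp only [← sum_mul, ha_col, one_mul]
    rwa [sum_add_distrib, sum_add_distrib (f := fun i => ∑ j, a k i j * ‖x j k - y‖ ^ 2), hswap,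
      ← sum_mul] at hsum
  have hg : Antitone fun k => C * c k := hc_anti.const_mul hC0
  have hgrowth : ∀ y ∈ ⋂ i, X i, ∀ k t,
      ∑ i, ‖x i (k + t) - y‖ ^ 2 ≤ ∑ i, ‖x i k - y‖ ^ 2 + t * (C * c k) := by
    intro y hy k t
    induction t with
    | zero => simp
    | succ t ih =>
      have h1 := hdrift y hy (k + t)
      have h2 : C * c (k + t) ≤ C * c k := hg (Nat.le_add_right k t)
      have h3 := hP (k + t)
      rw [← add_assoc]
      push_cast
      linarith
  have hglim : Tendsto (fun k => C * c k) atTop (𝓝 0) := by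
    have h := hc_sq.tendsto_atTop_zero.sqrt
    simp only [Real.sqrt_zero, Real.sqrt_sq (hc_pos _).le] at h
    simpa using h.const_mul C
  have hxbar : xbar ∈ ⋂ i, X i := hball (mem_ball_self hρ)
  have hWB : ∀ k, ∑ i, ‖x i k - xbar‖ ^ 2 ≤ ∑ i, R i ^ 2 := fun k =>
    sum_le_sum fun i _ => pow_le_pow_left₀ (norm_nonneg _) (hR i _ (hxX i k)) 2
  -- Every late window contains a time of near consensus.
  obtain ⟨K, hK0, hK⟩ := exists_norm_sub_le_of_reflTransGen
    (E := EuclideanSpace ℝ (Fin n)) hconn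
  have hnear : ∀ δ > 0, ∃ L : ℕ, ∀ᶠ k in atTop, ∃ l, k ≤ l ∧ l ≤ k + L ∧
      ∀ i j, ‖x i l - x j l‖ ≤ δ := by
    intro δ hδ
    set s : ℝ := δ / ((K + 1) * (2 * T + 1)) with hs
    have hs0 : 0 < s := by positivity
    have hsσ : 2 * √(η * (s / 2) ^ 2 / η) = s := by
      rw [mul_div_cancel_left₀ _ hη0.ne', Real.sqrt_sq (by positivity)]
      ring
    have hσ : 0 < η * (s / 2) ^ 2 := by positivity
    obtain ⟨L, hL⟩ := exists_block_le_of_drift (fun k => sum_nonneg fun i _ => sq_nonneg _) hWB hP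
      (hdrift xbar hxbar) hg T hσ
    refine ⟨L, ?_⟩
    have hsmall : ∀ᶠ k in atTop, T * (C * c k) ≤ η * (s / 2) ^ 2 / 2 := by
      have h := hglim.const_mul (T : ℝ)
      rw [mul_zero] at h
      exact h.eventually_le_const (half_pos hσ)
    filter_upwards [hsmall] with k hk
    obtain ⟨l, hkl, hlL, hl⟩ := hL k hk
    refine ⟨l, hkl, hlL, ?_⟩
    have hblock := fun t ht => norm_sub_le_of_weighted_deviation_le hη0 hη1.le
      (ha_nonneg (l + t)) (ha_diag (l + t)) (ha_eta (l + t)) (hl t ht)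
    simp only [hsσ] at hblock
    have hedge : ∀ u v, {k : ℕ | 0 < a k v u}.Infinite → ‖x u l - x v l‖ ≤ (2 * T + 1) * s := by
      intro u v huv
      obtain ⟨q, hlq, hqT, hq⟩ := hTcomm u v huv l
      obtain ⟨t, rfl⟩ := Nat.exists_eq_add_of_le hlq
      have ht : t < T := by omega
      rw [norm_sub_rev]
      exact norm_sub_le_of_small_steps (fun t ht => (hblock t ht).1) ht ((hblock t ht).2 v u hq)
    intro i j
    calc ‖x i l - x j l‖ ≤ K * ((2 * T + 1) * s) :=
          hK (fun i => x i l) _ (by positivity) hedge i j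
      _ ≤ (K + 1) * ((2 * T + 1) * s) := by gcongr; linarith
      _ = δ := by rw [hs]; field_simp
  -- Near consensus, all iterates are close to one feasible point.
  set i₀ : Fin m := 0
  set D : ℝ := 2 * |R i₀| / ρ + 1 with hD
  have hD0 : 0 < D := by positivity
  have hfeas : ∀ δ > 0, ∀ l, (∀ i j, ‖x i l - x j l‖ ≤ δ) →
      ∃ y ∈ ⋂ i, X i, ∀ i, ‖x i l - y‖ ≤ δ * D := by
    intro δ hδ l hl
    obtain ⟨y, hy, hyn⟩ := exists_mem_forall_norm_sub_le hXconv hρ hball (fun i => hxX i l) hδ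
      (hl i₀)
    refine ⟨y, hy, fun i => ?_⟩
    have h1 := norm_sub_le_norm_sub_add_norm_sub (x i l) (x i₀ l) y
    have h2 : δ * (2 * ‖x i₀ l - xbar‖ / ρ) ≤ δ * (2 * |R i₀| / ρ) := by
      gcongr
      exact (hR i₀ _ (hxX i₀ l)).trans (le_abs_self _)
    have h3 := hl i i₀
    rw [hD]
    linarith
  intro i
  rw [Metric.tendsto_atTop]
  intro ε hε
  have hmpos : (0 : ℝ) < m := by exact_mod_cast Nat.pos_of_ne_zero hm0.out
  set r : ℝ := ε / 3 with hr
  have hr0 : 0 < r := by positivity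
  set δ : ℝ := r / (2 * m * D) with hδ
  have hδ0 : 0 < δ := by positivity
  obtain ⟨L, hL⟩ := hnear δ hδ0
  have hsmall : ∀ᶠ k in atTop, L * (C * c k) ≤ r ^ 2 / 2 := by
    have h := hglim.const_mul (L : ℝ)
    rw [mul_zero] at h
    exact h.eventually_le_const (by positivity)
  obtain ⟨k₀, hk₀⟩ := eventually_atTop.1 (hL.and hsmall)
  refine ⟨k₀ + L, fun k hk => ?_⟩
  obtain ⟨⟨l, hkl, hlL, hl⟩, -⟩ := hk₀ (k - L) (by omega)
  obtain ⟨y, hy, hyl⟩ := hfeas δ hδ0 l hl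
  obtain ⟨t, rfl⟩ := Nat.exists_eq_add_of_le (show l ≤ k by omega)
  have hstart : ∑ i, ‖x i l - y‖ ^ 2 ≤ r ^ 2 / 2 := by
    have h1 : ∀ i, ‖x i l - y‖ ≤ r / (2 * m) := fun i => by
      refine (hyl i).trans_eq ?_
      rw [hδ]; field_simp
    calc ∑ i, ‖x i l - y‖ ^ 2 ≤ ∑ _i : Fin m, (r / (2 * m)) ^ 2 :=
          sum_le_sum fun i _ => pow_le_pow_left₀ (norm_nonneg _) (h1 i) 2
      _ = r ^ 2 / (4 * m) := by
          rw [sum_const, card_univ, Fintype.card_fin, nsmul_eq_mul]; field_simp; ring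
      _ ≤ r ^ 2 / 2 := by
          have : (2 : ℝ) ≤ m := by exact_mod_cast hm
          gcongr
          linarith
  have hend : ∑ i, ‖x i (l + t) - y‖ ^ 2 ≤ r ^ 2 := by
    have h1 := hgrowth y hy l t
    have h2 := (hk₀ l (by omega)).2
    have h3 : (t : ℝ) * (C * c l) ≤ L * (C * c l) := by
      have := (hc_pos l).le
      gcongr
      omega
    linarith
  have hclose : ∀ i, ‖x i (l + t) - y‖ ≤ r := fun i => by
    refine le_of_sq_le_sq ?_ hr0.le
    exact (single_le_sum (f := fun i => ‖x i (l + t) - y‖ ^ 2) (fun i _ => sq_nonneg _)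
      (mem_univ i)).trans hend
  have hmean : ‖v (l + t) - y‖ ≤ r := by
    have h := norm_mean_sub_le hclose
    rwa [Fintype.card_fin, ← hv] at h
  have h := norm_sub_le_norm_sub_add_norm_sub (x i (l + t)) y (v (l + t))
  rw [norm_sub_rev y] at h
  rw [dist_zero_right, norm_norm]
  linarith [hclose i]
end
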